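/- arXiv:2007.01624 — 3 statements merged into one kernel-verified Lean document; each statement's English description precedes it below -/
import Mathlib

section
/- Let β > 0 and let μ₋ be a positive Radon measure on ℝ with μ₋([x, x+1]) ≤ β for all x ∈ ℝ. Let 0 < d ≤ 1 and let f : ℝ → ℂ be locally absolutely continuous with f ∈ L²(ℝ) and a.e. derivative f′ ∈ L²(ℝ). Then ∫_ℝ |f|² dμ₋ ≤ (2β/d)·∫_ℝ |f(x)|² dx + βd·∫_ℝ |f′(x)|² dx. -/
open MeasureTheory Set ENNReal

/-- Cauchy–Schwarz against the constant function `1` on a bounded interval. -/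
theorem sq_integral_norm_le {E : Type*} [NormedAddCommGroup E] {g : ℝ → E} {a b : ℝ}
    (hab : a ≤ b) (hg : IntervalIntegrable g volume a b)
    (hg2 : IntervalIntegrable (fun x => ‖g x‖ ^ 2) volume a b) :
    (∫ x in a..b, ‖g x‖) ^ 2 ≤ (b - a) * ∫ x in a..b, ‖g x‖ ^ 2 := by
  rcases hab.eq_or_lt with rfl | hlt
  · simp
  have hL : 0 < b - a := sub_pos.2 hlt
  set u := ∫ x in a..b, ‖g x‖ with hu
  set m := u / (b - a)
  have h0 : 0 ≤ ∫ x in a..b, (‖g x‖ - m) ^ 2 :=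
    intervalIntegral.integral_nonneg hab fun x _ => sq_nonneg _
  have h1 : ∫ x in a..b, (‖g x‖ - m) ^ 2 =
      (∫ x in a..b, ‖g x‖ ^ 2) - 2 * m * u + m ^ 2 * (b - a) := by
    have : ∀ x, (‖g x‖ - m) ^ 2 = ‖g x‖ ^ 2 - 2 * m * ‖g x‖ + m ^ 2 := fun x => by ring
    simp_rw [this]
    rw [intervalIntegral.integral_add (hg2.sub (hg.norm.const_mul _)) intervalIntegrable_const,
      intervalIntegral.integral_sub hg2 (hg.norm.const_mul _),
      intervalIntegral.integral_const_mul, intervalIntegral.integral_const,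
      smul_eq_mul, ← hu]
    ring
  have h2 : m * (b - a) = u := div_mul_cancel₀ _ hL.ne'
  rw [h1] at h0
  have h3 := mul_nonneg hL.le h0
  have h4 : (b - a) * ((∫ x in a..b, ‖g x‖ ^ 2) - 2 * m * u + m ^ 2 * (b - a)) =
      (b - a) * (∫ x in a..b, ‖g x‖ ^ 2) - u ^ 2 := by
    linear_combination (m * (b - a) - u) * h2
  linarith

theorem integral_abs_sub_le {a b x : ℝ} (hx : x ∈ Icc a b) :
    ∫ y in a..b, |x - y| ≤ (b - a) ^ 2 / 2 := by
  have hc : Continuous fun y : ℝ => |x - y| := by fun_prop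
  rw [← intervalIntegral.integral_add_adjacent_intervals (hc.intervalIntegrable a x)
    (hc.intervalIntegrable x b)]
  have h1 : ∫ y in a..x, |x - y| = ∫ y in a..x, (x - y) :=
    intervalIntegral.integral_congr fun y hy => by
      rw [uIcc_of_le hx.1] at hy
      exact abs_of_nonneg (sub_nonneg.2 hy.2)
  have h2 : ∫ y in x..b, |x - y| = ∫ y in x..b, (y - x) :=
    intervalIntegral.integral_congr fun y hy => by
      rw [uIcc_of_le hx.2] at hy
      exact (abs_sub_comm x y).trans (abs_of_nonneg (sub_nonneg.2 hy.1))
  rw [h1, h2, intervalIntegral.integral_sub (by simp) (by simp),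
    intervalIntegral.integral_sub (by simp) (by simp)]
  simp only [intervalIntegral.integral_const, integral_id, smul_eq_mul]
  nlinarith [mul_nonneg (sub_nonneg.2 hx.1) (sub_nonneg.2 hx.2)]

/-- A one-dimensional Sobolev inequality on a bounded interval. -/
theorem norm_sq_le_of_eq_integral {f g : ℝ → ℂ} {a b : ℝ} (hab : a < b)
    (hg_loc : LocallyIntegrable g volume)
    (hfg : ∀ a b : ℝ, f b - f a = ∫ x in a..b, g x)
    (hf2 : Integrable (fun x => ‖f x‖ ^ 2))
    (hg2 : Integrable (fun x => ‖g x‖ ^ 2)) {x : ℝ} (hx : x ∈ Icc a b) :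
    ‖f x‖ ^ 2 ≤ (2 / (b - a)) * (∫ y in a..b, ‖f y‖ ^ 2) +
      (b - a) * (∫ y in a..b, ‖g y‖ ^ 2) := by
  have hL : 0 < b - a := sub_pos.2 hab
  set S := ∫ y in a..b, ‖g y‖ ^ 2
  have hgi : ∀ s t, IntervalIntegrable g volume s t := fun s t =>
    (hg_loc.integrableOn_isCompact isCompact_uIcc).intervalIntegrable
  have hS0 : 0 ≤ S := intervalIntegral.integral_nonneg hab.le fun y _ => sq_nonneg _
  have hord : ∀ s ∈ Icc a b, ∀ t ∈ Icc a b, s ≤ t → ‖f t - f s‖ ^ 2 ≤ (t - s) * S := by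
    intro s hs t ht hst
    calc ‖f t - f s‖ ^ 2 ≤ (∫ y in s..t, ‖g y‖) ^ 2 := by
          rw [hfg]
          gcongr
          exact intervalIntegral.norm_integral_le_integral_norm hst
      _ ≤ (t - s) * ∫ y in s..t, ‖g y‖ ^ 2 :=
          sq_integral_norm_le hst (hgi s t) hg2.intervalIntegrable
      _ ≤ (t - s) * S := by
          refine mul_le_mul_of_nonneg_left ?_ (sub_nonneg.2 hst)
          exact intervalIntegral.integral_mono_interval hs.1 hst ht.2
            (Filter.Eventually.of_forall fun y => sq_nonneg _) hg2.intervalIntegrable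
  have hdiff : ∀ y ∈ Icc a b, ‖f x - f y‖ ^ 2 ≤ |x - y| * S := by
    intro y hy
    rcases le_total y x with h | h
    · rw [abs_of_nonneg (sub_nonneg.2 h)]
      exact hord y hy x hx h
    · rw [abs_sub_comm, abs_of_nonneg (sub_nonneg.2 h), norm_sub_rev]
      exact hord x hx y hy h
  have hpt : ∀ y ∈ Icc a b, ‖f x‖ ^ 2 ≤ 2 * ‖f y‖ ^ 2 + 2 * S * |x - y| := by
    intro y hy
    have h1 : ‖f x‖ ≤ ‖f y‖ + ‖f x - f y‖ := norm_le_norm_add_norm_sub' _ _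
    have h2 := pow_le_pow_left₀ (norm_nonneg _) h1 2
    nlinarith [hdiff y hy, sq_nonneg (‖f y‖ - ‖f x - f y‖)]
  have hc : Continuous fun y : ℝ => 2 * S * |x - y| := by fun_prop
  have hi : IntervalIntegrable (fun y => 2 * ‖f y‖ ^ 2) volume a b :=
    (hf2.const_mul 2).intervalIntegrable
  have hint := intervalIntegral.integral_mono_on hab.le intervalIntegrable_const
    (hi.add (hc.intervalIntegrable a b)) hpt
  rw [intervalIntegral.integral_add hi (hc.intervalIntegrable a b),
    intervalIntegral.integral_const_mul, intervalIntegral.integral_const_mul,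
    intervalIntegral.integral_const, smul_eq_mul] at hint
  have habs := mul_le_mul_of_nonneg_left (integral_abs_sub_le hx)
    (mul_nonneg zero_le_two hS0)
  refine le_of_mul_le_mul_left (hint.trans ?_) hL
  have : (b - a) * ((2 / (b - a)) * (∫ y in a..b, ‖f y‖ ^ 2) + (b - a) * S) =
      2 * (∫ y in a..b, ‖f y‖ ^ 2) + 2 * S * ((b - a) ^ 2 / 2) := by
    field_simp
  rw [this]
  linarith

/-- Let `β > 0` and let `μ₋` be a positive Radon measure on `ℝ` with `μ₋([x, x+1]) ≤ β`
for all `x`.  Let `0 < d ≤ 1` and let `f : ℝ → ℂ` be locally absolutely continuous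
(i.e. an indefinite integral of a locally integrable function `g`) with `f ∈ L²(ℝ)` and
a.e. derivative `g ∈ L²(ℝ)`.  Then
`∫ |f|² dμ₋ ≤ (2β/d)·∫ |f|² dx + βd·∫ |f′|² dx`. -/
theorem measure_form_bound (β : ℝ) (hβ : 0 < β) (μm : Measure ℝ) [μm.Regular]
    (hμm : ∀ x : ℝ, μm (Icc x (x + 1)) ≤ ENNReal.ofReal β)
    (d : ℝ) (hd0 : 0 < d) (hd1 : d ≤ 1)
    (f g : ℝ → ℂ)
    (hg_loc : LocallyIntegrable g volume)
    (hfg : ∀ a b : ℝ, f b - f a = ∫ x in a..b, g x)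
    (hf2 : Integrable (fun x => ‖f x‖ ^ 2))
    (hg2 : Integrable (fun x => ‖g x‖ ^ 2)) :
    (∫⁻ x, (‖f x‖₊ : ℝ≥0∞) ^ 2 ∂μm) ≤
      ENNReal.ofReal ((2 * β / d) * (∫ x, ‖f x‖ ^ 2) + β * d * (∫ x, ‖g x‖ ^ 2)) := by
  have hmeas : ∀ n : ℤ, MeasurableSet (Ioc (n • d) ((n + 1) • d)) := fun _ => measurableSet_Ioc
  have hdisj := pairwise_disjoint_Ioc_zsmul d
  have hcover := iUnion_Ioc_zsmul hd0
  have hlen : ∀ n : ℤ, (n + 1) • d - n • d = d := fun n => by rw [add_smul, one_smul]; ring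
  have hlt : ∀ n : ℤ, n • d < (n + 1) • d := fun n => by linarith [hlen n]
  have hsum : ∀ {h : ℝ → ℝ}, Integrable h →
      HasSum (fun n : ℤ => ∫ y in (n • d)..((n + 1) • d), h y) (∫ y, h y) := by
    intro h hh
    have := hasSum_integral_iUnion hmeas hdisj hh.integrableOn
    rw [hcover, setIntegral_univ] at this
    simpa only [intervalIntegral.integral_of_le (hlt _).le] using this
  have htotal := ((hsum hf2).mul_left (2 * β / d)).add ((hsum hg2).mul_left (β * d))
  have hnonneg : ∀ n : ℤ, 0 ≤ 2 * β / d * (∫ y in (n • d)..((n + 1) • d), ‖f y‖ ^ 2) +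
      β * d * (∫ y in (n • d)..((n + 1) • d), ‖g y‖ ^ 2) := fun n => by
    have hF := intervalIntegral.integral_nonneg (μ := volume) (hlt n).le
      fun y _ => sq_nonneg ‖f y‖
    have hG := intervalIntegral.integral_nonneg (μ := volume) (hlt n).le
      fun y _ => sq_nonneg ‖g y‖
    positivity
  rw [← htotal.tsum_eq, ENNReal.ofReal_tsum_of_nonneg hnonneg htotal.summable,
    ← setLIntegral_univ, ← hcover, lintegral_iUnion hmeas hdisj]
  refine ENNReal.tsum_le_tsum fun n => ?_
  set C := 2 / d * (∫ y in (n • d)..((n + 1) • d), ‖f y‖ ^ 2) +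
      d * (∫ y in (n • d)..((n + 1) • d), ‖g y‖ ^ 2) with hC
  calc ∫⁻ x in Ioc (n • d) ((n + 1) • d), (‖f x‖₊ : ℝ≥0∞) ^ 2 ∂μm
      ≤ ∫⁻ _ in Ioc (n • d) ((n + 1) • d), ENNReal.ofReal C ∂μm := by
        refine setLIntegral_mono measurable_const fun x hx => ?_
        have h := norm_sq_le_of_eq_integral (hlt n) hg_loc hfg hf2 hg2 (Ioc_subset_Icc_self hx)
        rw [hlen] at h
        rw [← enorm_eq_nnnorm, ← ofReal_norm, ← ENNReal.ofReal_pow (norm_nonneg _)]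
        exact ENNReal.ofReal_le_ofReal h
    _ = ENNReal.ofReal C * μm (Ioc (n • d) ((n + 1) • d)) := setLIntegral_const _ _
    _ ≤ ENNReal.ofReal C * ENNReal.ofReal β := by
        gcongr
        refine (measure_mono ?_).trans (hμm (n • d))
        exact Ioc_subset_Icc_self.trans (Icc_subset_Icc_right (by linarith [hlen n]))
    _ = ENNReal.ofReal (2 * β / d * (∫ y in (n • d)..((n + 1) • d), ‖f y‖ ^ 2) +
          β * d * (∫ y in (n • d)..((n + 1) • d), ‖g y‖ ^ 2)) := by
        rw [← ENNReal.ofReal_mul' hβ.le, hC]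
        congr 1
        ring
end

section
/- Let μ be a positive Radon measure on ℝ such that q*_μ(x) → ∞ as |x| → ∞, and let ν be a positive Radon measure on ℝ with ν([x, x+1]) ≤ C₀ for all x ∈ ℝ and some finite constant C₀. Then there exist constants c₁, c₂ > 0 and R > 0 such that for all |x| ≥ R: c₁·q*_{μ+ν}(x) ≤ q*_μ(x) ≤ c₂·q*_{μ+ν}(x). -/
open MeasureTheory Set Filter ENNReal

/-- `d_μ(x) = sup {d ≥ 0 : d·μ([x − d/2, x + d/2]) ≤ 1}` (a real number; by Lean's
convention `sSup` of a set unbounded above is `0`, which corresponds to `d_μ(x) = ∞`). -/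
noncomputable def dFun (μ : Measure ℝ) (x : ℝ) : ℝ :=
  sSup {d : ℝ | 0 ≤ d ∧ ENNReal.ofReal d * μ (Icc (x - d / 2) (x + d / 2)) ≤ 1}

/-- Otelbaev's function `q*_μ(x) = 1/d_μ(x)²` (equal to `0` when `d_μ(x) = ∞`,
by the convention `1/0 = 0`). -/
noncomputable def qstar (μ : Measure ℝ) (x : ℝ) : ℝ := 1 / (dFun μ x) ^ 2

/-- The set `{d ≥ 0 : d·μ([x − d/2, x + d/2]) ≤ 1}` is closed under passing to smaller
nonnegative numbers. -/
theorem mul_measure_Icc_mono (μ : Measure ℝ) (x : ℝ) {s t : ℝ} (hst : s ≤ t) :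
    ENNReal.ofReal s * μ (Icc (x - s / 2) (x + s / 2)) ≤
      ENNReal.ofReal t * μ (Icc (x - t / 2) (x + t / 2)) := by
  gcongr

theorem dFun_nonneg (μ : Measure ℝ) (x : ℝ) : 0 ≤ dFun μ x :=
  Real.sSup_nonneg fun _ hd => hd.1

theorem bddAbove_of_dFun_pos {μ : Measure ℝ} {x : ℝ} (h : 0 < dFun μ x) :
    BddAbove {d : ℝ | 0 ≤ d ∧ ENNReal.ofReal d * μ (Icc (x - d / 2) (x + d / 2)) ≤ 1} := by
  by_contra hb
  exact h.ne' (Real.sSup_of_not_bddAbove hb)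

theorem mul_measure_Icc_le_one_of_lt_dFun {μ : Measure ℝ} {x t : ℝ} (h : t < dFun μ x) :
    ENNReal.ofReal t * μ (Icc (x - t / 2) (x + t / 2)) ≤ 1 := by
  obtain ⟨s, hs, hts⟩ := exists_lt_of_lt_csSup ⟨0, by simp⟩ h
  exact (mul_measure_Icc_mono μ x hts.le).trans hs.2

theorem dFun_anti {μ μ' : Measure ℝ} (hle : μ ≤ μ') {x : ℝ} (h : 0 < dFun μ x) :
    dFun μ' x ≤ dFun μ x :=
  csSup_le_csSup (bddAbove_of_dFun_pos h) ⟨0, by simp⟩ fun _ hd =>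
    ⟨hd.1, (mul_le_mul_right (hle _) _).trans hd.2⟩

/-- If `ν` has mass at most `C` on unit intervals and `d_μ(x)` is small compared with `1 / C`,
then `d_{μ+ν}(x)` is at least a quarter of `d_μ(x)`. -/
theorem quarter_dFun_le_dFun_add {μ ν : Measure ℝ} {C x : ℝ}
    (hν : ∀ y : ℝ, ν (Icc y (y + 1)) ≤ ENNReal.ofReal C)
    (hpos : 0 < dFun μ x) (hd : dFun μ x ≤ 1) (hdC : dFun μ x * C ≤ 1) :
    dFun μ x / 4 ≤ dFun (μ + ν) x := by
  set t := dFun μ x / 4 with ht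
  have hle : μ ≤ μ + ν := Measure.le_add_right le_rfl
  have hbdd : BddAbove {d : ℝ | 0 ≤ d ∧
      ENNReal.ofReal d * (μ + ν) (Icc (x - d / 2) (x + d / 2)) ≤ 1} := by
    refine (bddAbove_of_dFun_pos hpos).mono ?_
    rintro d ⟨hd0, hd1⟩
    exact ⟨hd0, (mul_le_mul_right (hle _) _).trans hd1⟩
  refine le_csSup hbdd ⟨by positivity, ?_⟩
  have hμt : ENNReal.ofReal t * μ (Icc (x - t / 2) (x + t / 2)) ≤ 2⁻¹ := by
    have h := mul_measure_Icc_le_one_of_lt_dFun (μ := μ) (x := x) (t := 2 * t) (by linarith)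
    rw [ENNReal.ofReal_mul zero_le_two, ENNReal.ofReal_ofNat, mul_assoc] at h
    rw [ENNReal.le_inv_iff_mul_le, mul_comm]
    refine le_trans ?_ h
    gcongr <;> linarith
  have hνt : ENNReal.ofReal t * ν (Icc (x - t / 2) (x + t / 2)) ≤ 2⁻¹ :=
    calc ENNReal.ofReal t * ν (Icc (x - t / 2) (x + t / 2))
        ≤ ENNReal.ofReal t * ν (Icc (x - t / 2) (x - t / 2 + 1)) := by
          refine mul_le_mul_right (measure_mono (Icc_subset_Icc_right ?_)) _
          linarith
      _ ≤ ENNReal.ofReal t * ENNReal.ofReal C := by gcongr; exact hν _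
      _ = ENNReal.ofReal (t * C) := (ENNReal.ofReal_mul (by positivity)).symm
      _ ≤ ENNReal.ofReal 2⁻¹ := ENNReal.ofReal_le_ofReal (by rw [ht]; linarith)
      _ = 2⁻¹ := by rw [ENNReal.ofReal_inv_of_pos two_pos, ENNReal.ofReal_ofNat]
  rw [Measure.add_apply, mul_add, ← ENNReal.inv_two_add_inv_two]
  exact add_le_add hμt hνt

/-- Perturbation of the Otelbaev function: if `q*_μ(x) → ∞` as `|x| → ∞` and `ν` is a
positive Radon measure with `ν([x, x+1]) ≤ C₀` for all `x`, then there are constants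
`c₁, c₂ > 0` such that `c₁·q*_{μ+ν}(x) ≤ q*_μ(x) ≤ c₂·q*_{μ+ν}(x)` for `|x|` large. -/
theorem qstar_perturbation (μ ν : Measure ℝ) [μ.Regular] [ν.Regular]
    (hμ : Tendsto (qstar μ) (cocompact ℝ) atTop)
    (C₀ : ℝ) (hν : ∀ x : ℝ, ν (Icc x (x + 1)) ≤ ENNReal.ofReal C₀) :
    ∃ c₁ c₂ R : ℝ, 0 < c₁ ∧ 0 < c₂ ∧ 0 < R ∧
      ∀ x : ℝ, R ≤ |x| →
        c₁ * qstar (μ + ν) x ≤ qstar μ x ∧ qstar μ x ≤ c₂ * qstar (μ + ν) x := by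
  have hlarge : ∀ᶠ x in comap norm atTop, (1 + |C₀|) ^ 2 ≤ qstar μ x := by
    rw [comap_norm_atTop, Metric.cobounded_eq_cocompact]
    exact hμ.eventually (eventually_ge_atTop _)
  obtain ⟨R, hR⟩ := eventually_atTop.1 (eventually_comap.1 hlarge)
  refine ⟨1 / 16, 1, max R 1, by norm_num, one_pos, by positivity, fun x hx => ?_⟩
  have hq : (1 + |C₀|) ^ 2 ≤ 1 / dFun μ x ^ 2 := hR |x| ((le_max_left _ _).trans hx) x rfl
  have hpos : 0 < dFun μ x := by
    refine (dFun_nonneg μ x).lt_of_ne' fun h0 => ?_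
    rw [h0] at hq
    norm_num at hq
    nlinarith [abs_nonneg C₀]
  have hprod : dFun μ x * (1 + |C₀|) ≤ 1 := by
    rw [le_div_iff₀ (by positivity), ← mul_pow] at hq
    rw [mul_comm]
    exact (sq_le_one_iff₀ (by positivity)).1 hq
  have hlow : dFun μ x / 4 ≤ dFun (μ + ν) x :=
    quarter_dFun_le_dFun_add hν hpos (by nlinarith [abs_nonneg C₀])
      (by nlinarith [le_abs_self C₀])
  have hup : dFun (μ + ν) x ≤ dFun μ x := dFun_anti (Measure.le_add_right le_rfl) hpos
  have hpos' : 0 < dFun (μ + ν) x := by linarith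
  unfold qstar
  constructor
  · calc 1 / 16 * (1 / dFun (μ + ν) x ^ 2) ≤ 1 / 16 * (1 / (dFun μ x / 4) ^ 2) := by gcongr
      _ = 1 / dFun μ x ^ 2 := by field_simp; norm_num
  · rw [one_mul]
    gcongr
end

section
/- Let μ be a positive Radon measure on ℝ with μ(ℝ) > 0 (i.e. μ₋ = 0), and define N_var(λ) := sup{dim L : L a linear subspace of D(a_μ) such that a_μ(f, f) < λ‖f‖² for every f ∈ L with f ≠ 0}. Then for every λ ≥ 0: 2·M(3λ/(16(π² + 1))) ≤ N_var(λ) ≤ M(4λ), where M(s) = √s·Leb({x ∈ ℝ : q*_μ(x) ≤ s}). (By Glazman's lemma N_var(λ) = N(λ, H_μ).) -/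
open MeasureTheory Set Filter ENNReal

/-- `∫ |f|² dν`, as a value in `[0, ∞]`. -/
noncomputable def sqInt (ν : Measure ℝ) (f : ℝ → ℂ) : ℝ≥0∞ :=
  ∫⁻ x, (‖f x‖₊ : ℝ≥0∞) ^ 2 ∂ν

/-- `f` belongs to the form domain `D(a_μ)` with a.e. derivative `g`:
`f` is locally absolutely continuous (an indefinite integral of the locally integrable
function `g`), `f ∈ L²(ℝ)`, `g = f′ ∈ L²(ℝ)` and `∫ |f|² dμ₊ < ∞`. -/
structure MemDom (μp : Measure ℝ) (f g : ℝ → ℂ) : Prop where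
  locInt : LocallyIntegrable g volume
  fund : ∀ a b : ℝ, f b - f a = ∫ x in a..b, g x
  f_L2 : sqInt volume f < ⊤
  g_L2 : sqInt volume g < ⊤
  f_mu : sqInt μp f < ⊤

/-- The quadratic form `a_μ(f, f) = ∫ |f′|² dx + ∫ |f|² dμ₊ − ∫ |f|² dμ₋`,
where `g` is the a.e. derivative of `f`. -/
noncomputable def formQ (μp μm : Measure ℝ) (f g : ℝ → ℂ) : ℝ :=
  (sqInt volume g).toReal + (sqInt μp f).toReal - (sqInt μm f).toReal

/-- `L` is a linear subspace of `D(a_μ)` on which `a_μ(f, f) < λ·‖f‖²` for every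
nonzero `f ∈ L` (the class of subspaces appearing in Glazman's lemma). -/
def GoodSubspace (μp μm : Measure ℝ) (lam : ℝ) (L : Submodule ℂ (ℝ → ℂ)) : Prop :=
  (∀ f ∈ L, ∃ g, MemDom μp f g) ∧
    ∀ f ∈ L, f ≠ 0 → ∀ g : ℝ → ℂ, MemDom μp f g →
      formQ μp μm f g < lam * (sqInt volume f).toReal

/-- The variational eigenvalue counting function: the supremum of the dimensions of
linear subspaces `L ⊆ D(a_μ)` with `a_μ(f, f) < λ‖f‖²` for all nonzero `f ∈ L`.
By Glazman's lemma this equals `N(λ, H_μ)`. -/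
noncomputable def NVar (μp μm : Measure ℝ) (lam : ℝ) : ℝ≥0∞ :=
  ⨆ L : {L : Submodule ℂ (ℝ → ℂ) // GoodSubspace μp μm lam L},
    ((Module.rank ℂ ↥(L : Submodule ℂ (ℝ → ℂ))).toENat : ℝ≥0∞)

lemma sqInt_eq_lintegral_enorm (ν : Measure ℝ) (f : ℝ → ℂ) :
    sqInt ν f = ∫⁻ x, ‖f x‖ₑ ^ 2 ∂ν := rfl

lemma sq_setLIntegral_le {g : ℝ → ℝ≥0∞} (hg : AEMeasurable g volume) (s : Set ℝ) :
    (∫⁻ t in s, g t) ^ 2 ≤ volume s * ∫⁻ t in s, g t ^ 2 := by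
  have h := ENNReal.lintegral_mul_le_Lp_mul_Lq (volume.restrict s)
    (p := 2) (q := 2) (by constructor <;> norm_num) (f := fun _ => 1) (g := g)
    aemeasurable_const hg.restrict
  have h2 : ∀ z : ℝ≥0∞, (z ^ (1 / 2 : ℝ)) ^ 2 = z := fun z => by
    rw [← ENNReal.rpow_natCast, ← ENNReal.rpow_mul]; norm_num
  calc (∫⁻ t in s, g t) ^ 2
      ≤ (volume s ^ (1 / 2 : ℝ) * (∫⁻ t in s, g t ^ 2) ^ (1 / 2 : ℝ)) ^ 2 := by
        gcongr
        simpa using h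
    _ = _ := by rw [mul_pow, h2, h2]

lemma enorm_add_sq_le (z w : ℂ) : ‖z + w‖ₑ ^ 2 ≤ 2 * ‖z‖ₑ ^ 2 + 2 * ‖w‖ₑ ^ 2 := by
  have h : ‖z + w‖₊ ^ 2 ≤ 2 * ‖z‖₊ ^ 2 + 2 * ‖w‖₊ ^ 2 := by
    rw [← NNReal.coe_le_coe]
    push_cast
    have := norm_add_le z w
    nlinarith [norm_nonneg (z + w), sq_nonneg (‖z‖ - ‖w‖)]
  simp only [enorm_eq_nnnorm]
  exact_mod_cast h

lemma MemDom.enorm_sub_sq_le {μ : Measure ℝ} {f g : ℝ → ℂ} (h : MemDom μ f g) {a b x y : ℝ}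
    (hx : x ∈ Icc a b) (hy : y ∈ Icc a b) :
    ‖f x - f y‖ₑ ^ 2 ≤ ENNReal.ofReal (b - a) * ∫⁻ t in Ioc a b, ‖g t‖ₑ ^ 2 := by
  have h1 : ‖f x - f y‖ₑ ≤ ∫⁻ t in Ioc a b, ‖g t‖ₑ := by
    calc ‖f x - f y‖ₑ = ‖∫ t in uIoc y x, g t‖ₑ := by
          rw [h.fund y x, ← ofReal_norm, ← ofReal_norm,
            intervalIntegral.norm_intervalIntegral_eq]
      _ ≤ ∫⁻ t in uIoc y x, ‖g t‖ₑ := enorm_integral_le_lintegral_enorm _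
      _ ≤ _ := lintegral_mono_set (Ioc_subset_Ioc (le_min hy.1 hx.1) (max_le hy.2 hx.2))
  calc ‖f x - f y‖ₑ ^ 2 ≤ (∫⁻ t in Ioc a b, ‖g t‖ₑ) ^ 2 := by gcongr
    _ ≤ _ := by
      simpa using sq_setLIntegral_le h.locInt.aestronglyMeasurable.enorm (Ioc a b)

/-- On an interval of length `l` that either contains a zero of `f` or has `μ`-mass at least
`1 / l`, the function is pointwise controlled by its local energy. -/
lemma MemDom.enorm_sq_le {μ : Measure ℝ} [IsLocallyFiniteMeasure μ] {f g : ℝ → ℂ}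
    (h : MemDom μ f g) {a b x : ℝ} (hx : x ∈ Icc a b)
    (hab : (∃ c ∈ Icc a b, f c = 0) ∨ 1 ≤ ENNReal.ofReal (b - a) * μ (Icc a b)) :
    ‖f x‖ₑ ^ 2 ≤ ENNReal.ofReal (b - a) * 2 *
      (∫⁻ t in Icc a b, ‖f t‖ₑ ^ 2 ∂μ + ∫⁻ t in Ioc a b, ‖g t‖ₑ ^ 2) := by
  set l := ENNReal.ofReal (b - a)
  set A := ∫⁻ t in Icc a b, ‖f t‖ₑ ^ 2 ∂μ
  set B := ∫⁻ t in Ioc a b, ‖g t‖ₑ ^ 2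
  rcases hab with ⟨c, hc, hfc⟩ | hm
  · have h1 := h.enorm_sub_sq_le hx hc
    rw [hfc, sub_zero] at h1
    calc _ ≤ l * 1 * B := by simpa using h1
      _ ≤ l * 2 * (A + B) := by
        gcongr
        · norm_num
        · exact le_add_self
  · set m := μ (Icc a b)
    have hm0 : m ≠ 0 := by
      intro h0
      simp [h0] at hm
    have hmt : m ≠ ⊤ := isCompact_Icc.measure_lt_top.ne
    have h1 : m * ‖f x‖ₑ ^ 2 ≤ m * (l * 2 * (A + B)) := by
      calc m * ‖f x‖ₑ ^ 2 = ∫⁻ y in Icc a b, ‖f x‖ₑ ^ 2 ∂μ := by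
            rw [setLIntegral_const, mul_comm]
        _ ≤ ∫⁻ y in Icc a b, (2 * ‖f y‖ₑ ^ 2 + 2 * (l * B)) ∂μ := by
            refine setLIntegral_mono' measurableSet_Icc fun y hy => ?_
            have h2 := enorm_add_sq_le (f y) (f x - f y)
            rw [add_sub_cancel] at h2
            refine h2.trans ?_
            gcongr
            exact h.enorm_sub_sq_le hx hy
        _ = 2 * A + 2 * (l * B) * m := by
            rw [lintegral_add_right _ measurable_const, setLIntegral_const,
              lintegral_const_mul' _ _ (by norm_num)]
        _ ≤ 2 * ((l * m) * A) + 2 * (l * B) * m := by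
            gcongr
            exact le_mul_of_one_le_left' hm
        _ = _ := by ring
    exact (ENNReal.mul_le_mul_iff_right hm0 hmt).1 h1

lemma tsum_setLIntegral_Ioc (ν : Measure ℝ) (F : ℝ → ℝ≥0∞) (a : ℝ) {l : ℝ} (hl : 0 < l) :
    ∑' k : ℤ, ∫⁻ x in Ioc (a + k • l) (a + (k + 1) • l), F x ∂ν = ∫⁻ x, F x ∂ν := by
  rw [← lintegral_iUnion (fun _ => measurableSet_Ioc) (pairwise_disjoint_Ioc_add_zsmul a l),
    iUnion_Ioc_add_zsmul hl, setLIntegral_univ]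

lemma tsum_setLIntegral_Ico (ν : Measure ℝ) (F : ℝ → ℝ≥0∞) (a : ℝ) {l : ℝ} (hl : 0 < l) :
    ∑' k : ℤ, ∫⁻ x in Ico (a + k • l) (a + (k + 1) • l), F x ∂ν = ∫⁻ x, F x ∂ν := by
  rw [← lintegral_iUnion (fun _ => measurableSet_Ico) (pairwise_disjoint_Ico_add_zsmul a l),
    iUnion_Ico_add_zsmul hl, setLIntegral_univ]

lemma tsum_setLIntegral_Icc_le (ν : Measure ℝ) (F : ℝ → ℝ≥0∞) (a : ℝ) {l : ℝ} (hl : 0 < l) :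
    ∑' k : ℤ, ∫⁻ x in Icc (a + k • l) (a + (k + 1) • l), F x ∂ν ≤ 2 * ∫⁻ x, F x ∂ν := by
  calc _ ≤ ∑' k : ℤ, (∫⁻ x in Ioc (a + k • l) (a + (k + 1) • l), F x ∂ν +
        ∫⁻ x in Ico (a + k • l) (a + (k + 1) • l), F x ∂ν) := by
        refine ENNReal.tsum_le_tsum fun k => ?_
        refine (lintegral_mono_set ?_).trans (lintegral_union_le _ _ _)
        intro x hx
        rcases hx.1.eq_or_lt with h | h
        · refine Or.inr ⟨hx.1, ?_⟩
          rw [← h, add_smul, one_smul]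
          linarith
        · exact Or.inl ⟨h, hx.2⟩
    _ = _ := by
        rw [ENNReal.tsum_add, tsum_setLIntegral_Ioc _ _ _ hl, tsum_setLIntegral_Ico _ _ _ hl,
          two_mul]

lemma MemDom.sqInt_le {μ : Measure ℝ} [IsLocallyFiniteMeasure μ] {f g : ℝ → ℂ}
    (h : MemDom μ f g) (a : ℝ) {l : ℝ} (hl : 0 < l)
    (hk : ∀ k : ℤ, (∃ c ∈ Icc (a + k • l) (a + (k + 1) • l), f c = 0) ∨
      1 ≤ ENNReal.ofReal l * μ (Icc (a + k • l) (a + (k + 1) • l))) :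
    sqInt volume f ≤ ENNReal.ofReal (4 * l ^ 2) * (sqInt μ f + sqInt volume g) := by
  have hlen : ∀ k : ℤ, a + (k + 1) • l - (a + k • l) = l := fun k => by
    rw [add_smul, one_smul]; ring
  simp only [sqInt_eq_lintegral_enorm]
  set L := ENNReal.ofReal l
  have hL : ENNReal.ofReal (4 * l ^ 2) = L * (L * 2) * 2 := by
    rw [ENNReal.ofReal_mul (by norm_num), ENNReal.ofReal_pow hl.le]
    norm_num
    ring
  calc ∫⁻ x, ‖f x‖ₑ ^ 2
      = ∑' k : ℤ, ∫⁻ x in Ioc (a + k • l) (a + (k + 1) • l), ‖f x‖ₑ ^ 2 :=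
        (tsum_setLIntegral_Ioc _ _ a hl).symm
    _ ≤ ∑' k : ℤ, L * (L * 2) * (∫⁻ t in Icc (a + k • l) (a + (k + 1) • l), ‖f t‖ₑ ^ 2 ∂μ +
          ∫⁻ t in Ioc (a + k • l) (a + (k + 1) • l), ‖g t‖ₑ ^ 2) := by
        refine ENNReal.tsum_le_tsum fun k => ?_
        refine (setLIntegral_mono' measurableSet_Ioc fun x hx =>
          h.enorm_sq_le (Ioc_subset_Icc_self hx) ?_).trans ?_
        · rw [hlen]; exact hk k
        · rw [setLIntegral_const, Real.volume_Ioc, hlen]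
          apply le_of_eq
          ring
    _ ≤ L * (L * 2) * (2 * ∫⁻ t, ‖f t‖ₑ ^ 2 ∂μ + ∫⁻ t, ‖g t‖ₑ ^ 2) := by
        rw [ENNReal.tsum_mul_left, ENNReal.tsum_add, tsum_setLIntegral_Ioc _ _ _ hl]
        gcongr
        exact tsum_setLIntegral_Icc_le _ _ _ hl
    _ ≤ L * (L * 2) * (2 * ∫⁻ t, ‖f t‖ₑ ^ 2 ∂μ + 2 * ∫⁻ t, ‖g t‖ₑ ^ 2) := by
        gcongr
        exact le_mul_of_one_le_left' (by norm_num)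
    _ = _ := by rw [hL]; ring

/-- Averaging over translates of a lattice of mesh `l`: some translate meets `E` in at most
`|E| / l` points. -/
lemma exists_tsum_indicator_le {E : Set ℝ} (hE : MeasurableSet E) {l : ℝ} (hl : 0 < l) :
    ∃ t : ℝ, ∑' k : ℤ, E.indicator (1 : ℝ → ℝ≥0∞) (t + k • l) ≤
      volume E / ENNReal.ofReal l := by
  have hmeas : ∀ k : ℤ, Measurable fun t : ℝ => E.indicator (1 : ℝ → ℝ≥0∞) (t + k • l) :=
    fun k => (measurable_one.indicator hE).comp (measurable_id.add_const _)
  have hvol : volume (Ioc 0 l) = ENNReal.ofReal l := by simp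
  obtain ⟨t, -, ht⟩ := exists_le_setLAverage (μ := volume) (s := Ioc 0 l)
    (f := fun t => ∑' k : ℤ, E.indicator (1 : ℝ → ℝ≥0∞) (t + k • l))
    (by simpa using hl) (by simp) (Measurable.tsum hmeas).aemeasurable
  refine ⟨t, ht.trans_eq ?_⟩
  rw [setLAverage_eq, hvol, lintegral_tsum fun k => (hmeas k).aemeasurable]
  congr 1
  rw [← lintegral_indicator_one hE, ← tsum_setLIntegral_Ioc volume _ 0 hl]
  congr 1
  ext k
  have hp : MeasurePreserving (fun t : ℝ => t + k • l) volume volume :=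
    measurePreserving_add_right _ _
  rw [← hp.setLIntegral_comp_preimage measurableSet_Ioc (measurable_one.indicator hE)]
  congr 2
  ext x
  simp [add_mul]

lemma bddAbove_dFun {μ : Measure ℝ} (hμ : μ univ ≠ 0) (x : ℝ) :
    BddAbove {d : ℝ | 0 ≤ d ∧ ENNReal.ofReal d * μ (Icc (x - d / 2) (x + d / 2)) ≤ 1} := by
  obtain ⟨n, hn⟩ : ∃ n : ℕ, μ (Icc (x - (n : ℝ) / 2) (x + (n : ℝ) / 2)) ≠ 0 := by
    by_contra! h
    refine hμ (measure_mono_null ?_ (measure_iUnion_null h))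
    intro y _
    obtain ⟨n, hn⟩ := exists_nat_ge (2 * |y - x|)
    have := abs_le.1 (show |y - x| ≤ n / 2 by linarith)
    exact mem_iUnion.2 ⟨n, by linarith [this.1], by linarith [this.2]⟩
  set m := μ (Icc (x - (n : ℝ) / 2) (x + (n : ℝ) / 2))
  refine ⟨max n (m⁻¹).toReal, fun d ⟨hd0, hd⟩ => ?_⟩
  rcases le_total d n with h | h
  · exact h.trans (le_max_left _ _)
  · refine le_trans ?_ (le_max_right _ _)
    refine (ENNReal.ofReal_le_iff_le_toReal (ENNReal.inv_ne_top.2 hn)).1 ?_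
    refine ENNReal.le_inv_iff_mul_le.2 (le_trans ?_ hd)
    gcongr
    exact measure_mono (Icc_subset_Icc (by linarith) (by linarith))

lemma one_lt_of_dFun_lt {μ : Measure ℝ} (hμ : μ univ ≠ 0) {x l : ℝ} (hl : 0 ≤ l)
    (h : dFun μ x < l) : 1 < ENNReal.ofReal l * μ (Icc (x - l / 2) (x + l / 2)) := by
  by_contra! h'
  exact h.not_ge (le_csSup (bddAbove_dFun hμ x) ⟨hl, h'⟩)

lemma le_one_of_lt_dFun {μ : Measure ℝ} {x l : ℝ}
    (h : l < dFun μ x) : ENNReal.ofReal l * μ (Icc (x - l / 2) (x + l / 2)) ≤ 1 := by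
  obtain ⟨d, ⟨-, hd⟩, hld⟩ := exists_lt_of_lt_csSup
    ⟨0, by simp⟩ h
  refine le_trans ?_ hd
  gcongr

lemma dFun_pos {μ : Measure ℝ} [IsLocallyFiniteMeasure μ] (hμ : μ univ ≠ 0) (x : ℝ) :
    0 < dFun μ x := by
  set m := μ (Icc (x - 1 / 2) (x + 1 / 2))
  have hm : m ≠ ⊤ := isCompact_Icc.measure_lt_top.ne
  have hpos : 0 < 1 / (1 + m.toReal) := by positivity
  have hle : 1 / (1 + m.toReal) ≤ 1 := by
    rw [div_le_one (by positivity)]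
    linarith [m.toReal_nonneg]
  refine hpos.trans_le (le_csSup (bddAbove_dFun hμ x) ⟨hpos.le, ?_⟩)
  calc _ ≤ ENNReal.ofReal (1 / (1 + m.toReal)) * m := by
        gcongr
        exact measure_mono (Icc_subset_Icc (by linarith) (by linarith))
    _ = ENNReal.ofReal (1 / (1 + m.toReal) * m.toReal) := by
        rw [ENNReal.ofReal_mul hpos.le, ENNReal.ofReal_toReal hm]
    _ ≤ ENNReal.ofReal 1 := by
        refine ENNReal.ofReal_le_ofReal ?_
        rw [one_div_mul_eq_div, div_le_one (by positivity)]
        linarith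
    _ = 1 := by simp

lemma qstar_le_iff {μ : Measure ℝ} [IsLocallyFiniteMeasure μ] (hμ : μ univ ≠ 0) (x : ℝ) {l : ℝ}
    (hl : 0 < l) : qstar μ x ≤ 1 / l ^ 2 ↔ l ≤ dFun μ x := by
  have hd := dFun_pos hμ x
  rw [qstar, one_div_le_one_div (by positivity) (by positivity), pow_le_pow_iff_left₀ hl.le hd.le
    two_ne_zero]

lemma formQ_zero (μ : Measure ℝ) (f g : ℝ → ℂ) :
    formQ μ 0 f g = (sqInt volume g).toReal + (sqInt μ f).toReal := by
  simp [formQ, sqInt]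

lemma nVar_zero_le (μ : Measure ℝ) : NVar μ 0 0 ≤ 0 := by
  refine iSup_le fun ⟨L, hL⟩ => ?_
  have : L = ⊥ := by
    refine (Submodule.eq_bot_iff _).2 fun f hf => ?_
    by_contra h0
    obtain ⟨g, hg⟩ := hL.1 f hf
    have := hL.2 f hf h0 g hg
    rw [formQ_zero, zero_mul] at this
    exact this.not_ge (by positivity)
  subst this
  simp

lemma MemDom.le_formQ {μ : Measure ℝ} [IsLocallyFiniteMeasure μ] {f g : ℝ → ℂ}
    (h : MemDom μ f g) (a : ℝ) {l : ℝ} (hl : 0 < l)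
    (hk : ∀ k : ℤ, (∃ c ∈ Icc (a + k • l) (a + (k + 1) • l), f c = 0) ∨
      1 ≤ ENNReal.ofReal l * μ (Icc (a + k • l) (a + (k + 1) • l))) :
    (sqInt volume f).toReal ≤ 4 * l ^ 2 * formQ μ 0 f g := by
  have h1 := h.sqInt_le a hl hk
  have hfin : sqInt μ f + sqInt volume g ≠ ⊤ := ENNReal.add_ne_top.2 ⟨h.f_mu.ne, h.g_L2.ne⟩
  have h2 := ENNReal.toReal_mono (ENNReal.mul_ne_top ENNReal.ofReal_ne_top hfin) h1
  rw [ENNReal.toReal_mul, ENNReal.toReal_ofReal (by positivity),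
    ENNReal.toReal_add h.f_mu.ne h.g_L2.ne] at h2
  rw [formQ_zero]
  linarith

/-- If the functions in a subspace are determined by their values on a finite set, the dimension
of the subspace is at most the cardinality of that set. -/
lemma toENat_rank_le_card {L : Submodule ℂ (ℝ → ℂ)} {ι : Type} (K : Finset ι) (p : ι → ℝ)
    (h : ∀ f ∈ L, (∀ k ∈ K, f (p k) = 0) → f = 0) :
    (Module.rank ℂ L).toENat ≤ K.card := by
  let T : L →ₗ[ℂ] (K → ℂ) :=
    (LinearMap.pi fun k : K => LinearMap.proj (p k)) ∘ₗ L.subtype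
  have hT : Function.Injective T := by
    rw [← LinearMap.ker_eq_bot, LinearMap.ker_eq_bot']
    rintro ⟨f, hf⟩ hTf
    exact Subtype.ext (h f hf fun k hk => congrFun hTf ⟨k, hk⟩)
  have := LinearMap.rank_le_of_injective T hT
  rw [rank_fun', Fintype.card_coe] at this
  exact Cardinal.toENat_le_natCast.2 this

lemma nVar_le {μ : Measure ℝ} [IsLocallyFiniteMeasure μ] (hμ : μ univ ≠ 0) {l : ℝ}
    (hl : 0 < l) :
    NVar μ 0 (1 / (4 * l ^ 2)) ≤ volume {x | l ≤ dFun μ x} / ENNReal.ofReal l := by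
  set E := {x | l ≤ dFun μ x}
  refine iSup_le fun ⟨L, hL⟩ => ?_
  obtain ⟨t, ht⟩ := exists_tsum_indicator_le (measurableSet_toMeasurable volume E) hl
  rw [measure_toMeasurable] at ht
  refine le_trans ?_ ht
  set F := toMeasurable volume E
  set u : ℤ → ℝ≥0∞ := fun k => F.indicator 1 (t + k • l)
  by_cases htop : ∑' k, u k = ⊤
  · simp [htop]
  have hfin : {k | 1 ≤ u k}.Finite := ENNReal.finite_const_le_of_tsum_ne_top htop one_ne_zero
  have hcard : (hfin.toFinset.card : ℝ≥0∞) ≤ ∑' k, u k := by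
    refine le_trans ?_ (ENNReal.sum_le_tsum hfin.toFinset)
    rw [← nsmul_one, ← Finset.sum_const]
    exact Finset.sum_le_sum fun k hk => (hfin.mem_toFinset.1 hk)
  refine le_trans ?_ hcard
  have hrank := toENat_rank_le_card (L := L) hfin.toFinset (fun k : ℤ => t + k • l) ?_
  · exact_mod_cast ENat.toENNReal_le.2 hrank
  intro f hf hzero
  by_contra hf0
  obtain ⟨g, hg⟩ := hL.1 f hf
  have hlt := hL.2 f hf hf0 g hg
  have hle := hg.le_formQ (t - l / 2) hl fun k => ?_
  · rw [one_div_mul_eq_div, lt_div_iff₀ (by positivity)] at hlt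
    linarith
  · have h1 : t - l / 2 + k • l = t + k • l - l / 2 := by ring
    have h2 : t - l / 2 + (k + 1) • l = t + k • l + l / 2 := by
      rw [add_smul, one_smul]; ring
    rw [h1, h2]
    by_cases hk : t + k • l ∈ F
    · refine Or.inl ⟨t + k • l, ⟨by linarith, by linarith⟩, hzero k ?_⟩
      rw [hfin.mem_toFinset]
      exact (indicator_of_mem hk (1 : ℝ → ℝ≥0∞)).ge
    · exact Or.inr (one_lt_of_dFun_lt hμ hl.le
        (not_le.1 fun h => hk (subset_toMeasurable volume E h))).le

/-- The parabolic bump on `(a, b)`. -/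
def bump (a b x : ℝ) : ℝ := max 0 ((x - a) * (b - x))

/-- The derivative of `bump a b` away from `a` and `b`. -/
noncomputable def bumpDeriv (a b : ℝ) : ℝ → ℝ := (Ioo a b).indicator fun x => a + b - 2 * x

lemma continuous_bump (a b : ℝ) : Continuous (bump a b) := by
  unfold bump
  fun_prop

lemma bump_of_mem {a b x : ℝ} (hx : x ∈ Icc a b) : bump a b x = (x - a) * (b - x) :=
  max_eq_right (mul_nonneg (by linarith [hx.1]) (by linarith [hx.2]))

lemma bump_of_notMem {a b x : ℝ} (hab : a ≤ b) (hx : x ∉ Ioo a b) : bump a b x = 0 := by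
  refine max_eq_left ?_
  rcases le_or_gt x a with h | h
  · exact mul_nonpos_of_nonpos_of_nonneg (by linarith) (by linarith)
  · have : b ≤ x := not_lt.1 fun h' => hx ⟨h, h'⟩
    exact mul_nonpos_of_nonneg_of_nonpos (by linarith) (by linarith)

lemma measurable_bumpDeriv (a b : ℝ) : Measurable (bumpDeriv a b) :=
  (by fun_prop : Measurable fun x : ℝ => a + b - 2 * x).indicator measurableSet_Ioo

lemma integrable_bumpDeriv (a b : ℝ) : Integrable (bumpDeriv a b) :=
  (integrable_indicator_iff measurableSet_Ioo).2
    ((by fun_prop : Continuous fun x : ℝ => a + b - 2 * x).integrableOn_Icc.mono_set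
      Ioo_subset_Icc_self)

lemma hasDerivAt_bump {a b x : ℝ} (hab : a < b) (ha : x ≠ a) (hb : x ≠ b) :
    HasDerivAt (bump a b) (bumpDeriv a b x) x := by
  by_cases hx : x ∈ Ioo a b
  · have h1 : HasDerivAt (fun y : ℝ => (y - a) * (b - y)) (bumpDeriv a b x) x := by
      rw [bumpDeriv, indicator_of_mem hx]
      exact (((hasDerivAt_id' x).sub_const a).fun_mul ((hasDerivAt_id' x).const_sub b)).congr_deriv
        (by ring)
    refine h1.congr_of_eventuallyEq ?_
    filter_upwards [Ioo_mem_nhds hx.1 hx.2] with y hy using bump_of_mem (Ioo_subset_Icc_self hy)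
  · rw [bumpDeriv, indicator_of_notMem hx]
    have hx' : x ∈ (Icc a b)ᶜ := fun h => hx ⟨h.1.lt_of_ne' ha, h.2.lt_of_ne hb⟩
    refine (hasDerivAt_const x (0 : ℝ)).congr_of_eventuallyEq ?_
    filter_upwards [isClosed_Icc.isOpen_compl.mem_nhds hx'] with y hy
    exact bump_of_notMem hab.le fun h => hy (Ioo_subset_Icc_self h)

lemma bump_sub_bump {a b : ℝ} (hab : a < b) (c d : ℝ) :
    bump a b d - bump a b c = ∫ x in c..d, bumpDeriv a b x := by
  refine (integral_eq_of_hasDerivAt_off_countable (s := {a, b}) _ _ (by simp)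
    (continuous_bump a b).continuousOn (fun x hx => ?_)
    (integrable_bumpDeriv a b).intervalIntegrable).symm
  have := hx.2
  simp only [mem_insert_iff, mem_singleton_iff, not_or] at this
  exact hasDerivAt_bump hab this.1 this.2

lemma sqInt_ofReal (ν : Measure ℝ) (u : ℝ → ℝ) :
    sqInt ν (fun x => (u x : ℂ)) = ∫⁻ x, ENNReal.ofReal (u x ^ 2) ∂ν := by
  rw [sqInt_eq_lintegral_enorm]
  congr 1
  ext x
  rw [← ofReal_norm, Complex.norm_real, ← ENNReal.ofReal_pow (norm_nonneg _), Real.norm_eq_abs,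
    sq_abs]

lemma lintegral_ofReal_indicator {a b : ℝ} (hab : a ≤ b) {p : ℝ → ℝ} (hp : Continuous p)
    (hp0 : ∀ x, 0 ≤ p x) :
    ∫⁻ x, ENNReal.ofReal ((Ioo a b).indicator p x) = ENNReal.ofReal (∫ x in a..b, p x) := by
  rw [intervalIntegral.integral_of_le hab, integral_Ioc_eq_integral_Ioo,
    ← integral_indicator measurableSet_Ioo, ofReal_integral_eq_lintegral_ofReal]
  · exact (integrable_indicator_iff measurableSet_Ioo).2
      (hp.integrableOn_Icc.mono_set Ioo_subset_Icc_self)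
  · exact Eventually.of_forall fun x => indicator_nonneg (fun y _ => hp0 y) x

lemma sqInt_bump {a b : ℝ} (hab : a ≤ b) :
    sqInt volume (fun x => (bump a b x : ℂ)) = ENNReal.ofReal ((b - a) ^ 5 / 30) := by
  have h : ∀ x, bump a b x ^ 2 = (Ioo a b).indicator (fun x => ((x - a) * (b - x)) ^ 2) x := by
    intro x
    by_cases hx : x ∈ Ioo a b
    · rw [indicator_of_mem hx, bump_of_mem (Ioo_subset_Icc_self hx)]
    · rw [indicator_of_notMem hx, bump_of_notMem hab hx, zero_pow two_ne_zero]
  rw [sqInt_ofReal]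
  simp only [h]
  rw [lintegral_ofReal_indicator hab (by fun_prop) fun x => sq_nonneg _,
    integral_eq_of_hasDerivAt_off_countable (s := ∅)
      (fun x => (b - a) ^ 2 * (x - a) ^ 3 / 3 - (b - a) * (x - a) ^ 4 / 2 + (x - a) ^ 5 / 5)
      (fun x => ((x - a) * (b - x)) ^ 2) countable_empty (by fun_prop) (fun x _ => ?_)
      (Continuous.intervalIntegrable (by fun_prop) _ _)]
  · congr 1
    ring
  · have h1 := (hasDerivAt_id' x).sub_const a
    refine (((((h1.fun_pow 3).const_mul ((b - a) ^ 2)).div_const 3).fun_sub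
      (((h1.fun_pow 4).const_mul (b - a)).div_const 2)).fun_add
      ((h1.fun_pow 5).div_const 5)).congr_deriv ?_
    push_cast
    ring

lemma sqInt_bumpDeriv {a b : ℝ} (hab : a ≤ b) :
    sqInt volume (fun x => (bumpDeriv a b x : ℂ)) = ENNReal.ofReal ((b - a) ^ 3 / 3) := by
  have h : ∀ x, bumpDeriv a b x ^ 2 = (Ioo a b).indicator (fun x => (a + b - 2 * x) ^ 2) x := by
    intro x
    by_cases hx : x ∈ Ioo a b
    · rw [indicator_of_mem hx, bumpDeriv, indicator_of_mem hx]
    · rw [indicator_of_notMem hx, bumpDeriv, indicator_of_notMem hx, zero_pow two_ne_zero]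
  rw [sqInt_ofReal]
  simp only [h]
  rw [lintegral_ofReal_indicator hab (by fun_prop) fun x => sq_nonneg _,
    integral_eq_of_hasDerivAt_off_countable (s := ∅)
      (fun x => -(a + b - 2 * x) ^ 3 / 6)
      (fun x => (a + b - 2 * x) ^ 2) countable_empty (by fun_prop) (fun x _ => ?_)
      (Continuous.intervalIntegrable (by fun_prop) _ _)]
  · congr 1
    ring
  · refine (((((hasDerivAt_id' x).const_mul 2).const_sub (a + b)).fun_pow 3).fun_neg.div_const
      6).congr_deriv ?_
    push_cast
    ring

lemma sqInt_bump_le (ν : Measure ℝ) {a b : ℝ} (hab : a ≤ b) :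
    sqInt ν (fun x => (bump a b x : ℂ)) ≤ ENNReal.ofReal ((b - a) ^ 4 / 16) * ν (Icc a b) := by
  rw [sqInt_ofReal, ← setLIntegral_const, ← lintegral_indicator measurableSet_Icc]
  refine lintegral_mono fun x => ?_
  by_cases hx : x ∈ Icc a b
  · rw [indicator_of_mem hx, bump_of_mem hx]
    refine ENNReal.ofReal_le_ofReal ?_
    have h0 : 0 ≤ (x - a) * (b - x) := mul_nonneg (by linarith [hx.1]) (by linarith [hx.2])
    have h1 : (x - a) * (b - x) ≤ (b - a) ^ 2 / 4 := by nlinarith [sq_nonneg (a + b - 2 * x)]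
    calc ((x - a) * (b - x)) ^ 2 ≤ ((b - a) ^ 2 / 4) ^ 2 := by gcongr
      _ = _ := by ring
  · rw [bump_of_notMem hab fun h => hx (Ioo_subset_Icc_self h)]
    simp

lemma sqInt_sum {ι : Type*} [Fintype ι] (ν : Measure ℝ) {u : ι → ℝ → ℝ}
    (hu : ∀ k, Measurable (u k)) (hd : ∀ x i j, i ≠ j → u i x = 0 ∨ u j x = 0) (c : ι → ℂ) :
    sqInt ν (fun x => ∑ k, c k * u k x) =
      ∑ k, ‖c k‖ₑ ^ 2 * sqInt ν (fun x => (u k x : ℂ)) := by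
  simp only [sqInt_eq_lintegral_enorm]
  have h : ∀ x, ‖∑ k, c k * u k x‖ₑ ^ 2 = ∑ k, ‖c k‖ₑ ^ 2 * ‖(u k x : ℂ)‖ₑ ^ 2 := by
    intro x
    by_cases hx : ∃ i, u i x ≠ 0
    · obtain ⟨i, hi⟩ := hx
      have hj : ∀ j, j ≠ i → u j x = 0 := fun j hji => (hd x j i hji).resolve_right hi
      rw [Finset.sum_eq_single i (fun j _ hji => by simp [hj j hji]) (by simp),
        Finset.sum_eq_single i (fun j _ hji => by simp [hj j hji]) (by simp), enorm_mul, mul_pow]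
    · push Not at hx
      simp [hx]
  simp only [h]
  have hm : ∀ k, Measurable fun x => ‖(u k x : ℂ)‖ₑ ^ 2 := fun k => by
    have := hu k
    fun_prop
  rw [lintegral_finsetSum _ fun k _ => (hm k).const_mul _]
  exact Finset.sum_congr rfl fun k _ => lintegral_const_mul _ (hm k)

lemma MemDom.ae_eq {μ : Measure ℝ} {f g g' : ℝ → ℂ} (h : MemDom μ f g) (h' : MemDom μ f g') :
    g =ᵐ[volume] g' := by
  filter_upwards [LocallyIntegrable.ae_hasDerivAt_integral h.locInt,
    LocallyIntegrable.ae_hasDerivAt_integral h'.locInt] with x hx hx'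
  refine (hx 0).unique ?_
  simpa only [← h.fund, ← h'.fund] using hx' 0

lemma sqInt_sum_bump {ι : Type*} [Fintype ι] (ν : Measure ℝ) {a : ι → ℝ} {r : ℝ} (hr : 0 < r)
    (hd : ∀ i j, i ≠ j → Disjoint (Ioo (a i) (a i + r)) (Ioo (a j) (a j + r))) (c : ι → ℂ) :
    sqInt ν (fun x => ∑ k, c k * bump (a k) (a k + r) x) =
      ∑ k, ‖c k‖ₑ ^ 2 * sqInt ν (fun x => (bump (a k) (a k + r) x : ℂ)) := by
  refine sqInt_sum ν (fun k => (continuous_bump _ _).measurable) (fun x i j hij => ?_) c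
  by_contra! h
  exact Set.disjoint_left.1 (hd i j hij)
    (by_contra fun hx => h.1 (bump_of_notMem (by linarith) hx))
    (by_contra fun hx => h.2 (bump_of_notMem (by linarith) hx))

lemma sqInt_sum_bumpDeriv {ι : Type*} [Fintype ι] (ν : Measure ℝ) {a : ι → ℝ} {r : ℝ}
    (hd : ∀ i j, i ≠ j → Disjoint (Ioo (a i) (a i + r)) (Ioo (a j) (a j + r))) (c : ι → ℂ) :
    sqInt ν (fun x => ∑ k, c k * bumpDeriv (a k) (a k + r) x) =
      ∑ k, ‖c k‖ₑ ^ 2 * sqInt ν (fun x => (bumpDeriv (a k) (a k + r) x : ℂ)) := by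
  refine sqInt_sum ν (fun k => measurable_bumpDeriv _ _) (fun x i j hij => ?_) c
  by_contra! h
  exact Set.disjoint_left.1 (hd i j hij)
    (by_contra fun hx => h.1 (indicator_of_notMem hx _))
    (by_contra fun hx => h.2 (indicator_of_notMem hx _))

lemma memDom_sum_bump {μ : Measure ℝ} [IsLocallyFiniteMeasure μ] {ι : Type*} [Fintype ι]
    {a : ι → ℝ} {r : ℝ} (hr : 0 < r)
    (hd : ∀ i j, i ≠ j → Disjoint (Ioo (a i) (a i + r)) (Ioo (a j) (a j + r))) (c : ι → ℂ) :
    MemDom μ (fun x => ∑ k, c k * bump (a k) (a k + r) x)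
      (fun x => ∑ k, c k * bumpDeriv (a k) (a k + r) x) := by
  have hlt : ∀ k, a k < a k + r := fun k => by linarith
  have hint : ∀ k, Integrable fun x => c k * (bumpDeriv (a k) (a k + r) x : ℂ) := fun k =>
    (integrable_bumpDeriv _ _).ofReal.const_mul _
  refine ⟨(integrable_finsetSum _ fun k _ => hint k).locallyIntegrable, fun p q => ?_, ?_, ?_, ?_⟩
  · rw [intervalIntegral.integral_finsetSum fun k _ => (hint k).intervalIntegrable,
      ← Finset.sum_sub_distrib]
    refine Finset.sum_congr rfl fun k _ => ?_
    rw [intervalIntegral.integral_const_mul, intervalIntegral.integral_ofReal,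
      ← bump_sub_bump (hlt k)]
    push_cast
    ring
  · rw [sqInt_sum_bump _ hr hd]
    simp_rw [sqInt_bump (hlt _).le]
    exact ENNReal.sum_lt_top.2 fun k _ => ENNReal.mul_lt_top (by simp) ENNReal.ofReal_lt_top
  · rw [sqInt_sum_bumpDeriv _ hd]
    simp_rw [sqInt_bumpDeriv (hlt _).le]
    exact ENNReal.sum_lt_top.2 fun k _ => ENNReal.mul_lt_top (by simp) ENNReal.ofReal_lt_top
  · rw [sqInt_sum_bump _ hr hd]
    exact ENNReal.sum_lt_top.2 fun k _ => ENNReal.mul_lt_top (by simp)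
      ((sqInt_bump_le μ (hlt k).le).trans_lt
        (ENNReal.mul_lt_top ENNReal.ofReal_lt_top isCompact_Icc.measure_lt_top))

lemma card_le_nVar {μ : Measure ℝ} [IsLocallyFiniteMeasure μ] {ι : Type} [Fintype ι]
    {a : ι → ℝ} {r lam : ℝ} (hr : 0 < r)
    (hd : ∀ i j, i ≠ j → Disjoint (Ioo (a i) (a i + r)) (Ioo (a j) (a j + r)))
    (hμ : ∀ k, ENNReal.ofReal (2 * r) * μ (Icc (a k) (a k + r)) ≤ 1)
    (hlam : 175 / 16 < lam * r ^ 2) :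
    (Fintype.card ι : ℝ≥0∞) ≤ NVar μ 0 lam := by
  have hlt : ∀ k, a k < a k + r := fun k => by linarith
  let v : ι → ℝ → ℂ := fun k x => (bump (a k) (a k + r) x : ℂ)
  let T : (ι → ℂ) →ₗ[ℂ] (ℝ → ℂ) := Fintype.linearCombination ℂ v
  have hT : ∀ c, T c = fun x => ∑ k, c k * bump (a k) (a k + r) x := fun c => by
    ext x
    simp [T, v, Fintype.linearCombination_apply]
  have hvol : ∀ c, (sqInt volume (T c)).toReal = (∑ k, ‖c k‖ ^ 2) * (r ^ 5 / 30) := fun c => by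
    rw [hT, sqInt_sum_bump _ hr hd]
    simp_rw [sqInt_bump (hlt _).le, add_sub_cancel_left]
    rw [← Finset.sum_mul, ENNReal.toReal_mul, ENNReal.toReal_sum (by simp),
      ENNReal.toReal_ofReal (by positivity)]
    simp
  have hderiv : ∀ c : ι → ℂ, (sqInt volume (fun x => ∑ k, c k * bumpDeriv (a k) (a k + r) x)).toReal =
      (∑ k, ‖c k‖ ^ 2) * (r ^ 3 / 3) := fun c => by
    rw [sqInt_sum_bumpDeriv _ hd]
    simp_rw [sqInt_bumpDeriv (hlt _).le, add_sub_cancel_left]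
    rw [← Finset.sum_mul, ENNReal.toReal_mul, ENNReal.toReal_sum (by simp),
      ENNReal.toReal_ofReal (by positivity)]
    simp
  have hbump : ∀ k, sqInt μ (v k) ≤ ENNReal.ofReal (r ^ 3 / 32) := fun k => by
    refine (sqInt_bump_le μ (hlt k).le).trans ?_
    have h1 : (a k + r - a k) ^ 4 / 16 = r ^ 3 / 32 * (2 * r) := by ring
    rw [h1, ENNReal.ofReal_mul (by positivity), mul_assoc]
    exact mul_le_of_le_one_right' (hμ k)
  have hpot : ∀ c, (sqInt μ (T c)).toReal ≤ (∑ k, ‖c k‖ ^ 2) * (r ^ 3 / 32) := fun c => by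
    have h1 : sqInt μ (T c) ≤ (∑ k, ‖c k‖ₑ ^ 2) * ENNReal.ofReal (r ^ 3 / 32) := by
      rw [hT, sqInt_sum_bump _ hr hd, Finset.sum_mul]
      gcongr with k
      exact hbump k
    refine (ENNReal.toReal_mono (ENNReal.mul_ne_top (by simp) (by simp)) h1).trans_eq ?_
    rw [ENNReal.toReal_mul, ENNReal.toReal_sum (by simp), ENNReal.toReal_ofReal (by positivity)]
    simp
  have hpos : ∀ c : ι → ℂ, c ≠ 0 → 0 < ∑ k, ‖c k‖ ^ 2 := fun c hc => by
    obtain ⟨k, hk⟩ := Function.ne_iff.1 hc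
    exact Finset.sum_pos' (fun _ _ => by positivity)
      ⟨k, Finset.mem_univ k, by have := norm_pos_iff.2 hk; positivity⟩
  have hinj : Function.Injective T := by
    rw [← LinearMap.ker_eq_bot, LinearMap.ker_eq_bot']
    intro c hc
    by_contra h0
    have h1 := hvol c
    rw [hc] at h1
    have h2 := hpos c h0
    have : 0 < (∑ k, ‖c k‖ ^ 2) * (r ^ 5 / 30) := by positivity
    rw [← h1] at this
    simp [sqInt] at this
  have hgood : GoodSubspace μ 0 lam (LinearMap.range T) := by
    have hmem : ∀ c, MemDom μ (T c) (fun x => ∑ k, c k * bumpDeriv (a k) (a k + r) x) :=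
      fun c => hT c ▸ memDom_sum_bump hr hd c
    constructor
    · rintro _ ⟨c, rfl⟩
      exact ⟨_, hmem c⟩
    · rintro _ ⟨c, rfl⟩ hne g hg
      have hc : c ≠ 0 := by
        rintro rfl
        exact hne (map_zero T)
      have hgg : sqInt volume g =
          sqInt volume (fun x => ∑ k, c k * bumpDeriv (a k) (a k + r) x) :=
        lintegral_congr_ae ((hg.ae_eq (hmem c)).mono fun x hx => by simp only [hx])
      rw [formQ_zero, hgg, hderiv, hvol]
      have h1 := hpot c
      have h2 : r ^ 3 / 3 + r ^ 3 / 32 < lam * (r ^ 5 / 30) := by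
        have : 0 < r ^ 3 * (lam * r ^ 2 - 175 / 16) := by
          have : 0 < lam * r ^ 2 - 175 / 16 := by linarith
          positivity
        linarith
      have h3 := mul_lt_mul_of_pos_left h2 (hpos c hc)
      linarith
  have hrank : (Module.rank ℂ (LinearMap.range T)).toENat = Fintype.card ι := by
    rw [← (LinearEquiv.ofInjective T hinj).rank_eq, rank_fun', Cardinal.toENat_nat]
  refine le_trans ?_ (le_iSup _ ⟨LinearMap.range T, hgood⟩)
  rw [hrank]
  simp

lemma volume_le_nVar {μ : Measure ℝ} [IsLocallyFiniteMeasure μ] {r lam : ℝ} (hr : 0 < r)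
    {E : Set ℝ} (hE : ∀ x ∈ E, 2 * r < dFun μ x) (hlam : 175 / 16 < lam * r ^ 2) :
    volume E ≤ NVar μ 0 lam * ENNReal.ofReal r := by
  classical
  let J : ℤ → Set ℝ := fun k => Ioc (0 + k • r) (0 + (k + 1) • r)
  have hJ : ∀ k, J k = Ioc (k • r) (k • r + r) := fun k => by
    simp [J, add_mul]
  calc volume E ≤ ∑' k, volume (E ∩ J k) := by
        refine (measure_mono ?_).trans (measure_iUnion_le _)
        rw [← inter_iUnion, iUnion_Ioc_add_zsmul hr, inter_univ]
    _ ≤ _ := by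
        rw [ENNReal.tsum_eq_iSup_sum]
        refine iSup_le fun s => ?_
        set S := s.filter fun k => (E ∩ J k).Nonempty
        have hS : (S.card : ℝ≥0∞) ≤ NVar μ 0 lam := by
          rw [← Fintype.card_coe]
          refine card_le_nVar (a := fun k : S => (k : ℤ) • r) hr (fun i j hij => ?_)
            (fun k => ?_) hlam
          · have := pairwise_disjoint_Ioc_add_zsmul 0 r (Subtype.coe_injective.ne hij)
            change Disjoint (J i) (J j) at this
            rw [hJ, hJ] at this
            exact this.mono Ioo_subset_Ioc_self Ioo_subset_Ioc_self
          · obtain ⟨x, hxE, hxJ⟩ := (Finset.mem_filter.1 k.2).2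
            rw [hJ] at hxJ
            refine le_trans ?_ (le_one_of_lt_dFun (hE x hxE))
            have hsub : Icc ((k : ℤ) • r) ((k : ℤ) • r + r) ⊆
                Icc (x - 2 * r / 2) (x + 2 * r / 2) :=
              Icc_subset_Icc (by linarith [hxJ.2]) (by linarith [hxJ.1])
            gcongr
        calc ∑ k ∈ s, volume (E ∩ J k) = ∑ k ∈ S, volume (E ∩ J k) := by
              refine (Finset.sum_filter_of_ne fun k _ hk => ?_).symm
              exact nonempty_of_measure_ne_zero hk
          _ ≤ ∑ k ∈ S, ENNReal.ofReal r := by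
              refine Finset.sum_le_sum fun k _ => (measure_mono inter_subset_right).trans ?_
              rw [hJ, Real.volume_Ioc, add_sub_cancel_left]
          _ = S.card * ENNReal.ofReal r := by rw [Finset.sum_const, nsmul_eq_mul]
          _ ≤ _ := by gcongr

/-- Two-sided estimate for the spectral distribution function in the case of a positive
Radon measure potential `μ` (i.e. `μ₋ = 0`): for every `λ ≥ 0`,
`2·M(3λ/(16(π² + 1))) ≤ N(λ, H_μ) ≤ M(4λ)`, where
`M(s) = √s·Leb({x : q*_μ(x) ≤ s})`. -/
theorem spectral_two_sided_positive (μ : Measure ℝ) [μ.Regular] (hμ : μ univ ≠ 0)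
    (lam : ℝ) (hlam : 0 ≤ lam)
    (M : ℝ → ℝ≥0∞)
    (hM : ∀ s : ℝ, M s = ENNReal.ofReal (Real.sqrt s) * volume {x : ℝ | qstar μ x ≤ s}) :
    2 * M (3 * lam / (16 * (Real.pi ^ 2 + 1))) ≤ NVar μ 0 lam ∧
      NVar μ 0 lam ≤ M (4 * lam) := by
  rcases hlam.eq_or_lt with rfl | hpos
  · exact ⟨by simp [hM], (nVar_zero_le μ).trans zero_le⟩
  have hMd : ∀ s, 0 < s →
      M s = ENNReal.ofReal √s * volume {x | 1 / √s ≤ dFun μ x} := fun s hs => by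
    rw [hM]
    congr 3
    ext x
    rw [← qstar_le_iff hμ x (by positivity), div_pow, one_pow, one_div_one_div, Real.sq_sqrt hs.le]
  constructor
  · set s := 3 * lam / (16 * (Real.pi ^ 2 + 1)) with hs_def
    have hs : 0 < s := by positivity
    have hsq : √s ^ 2 = s := Real.sq_sqrt hs.le
    have hs_eq : lam = s * (16 * (Real.pi ^ 2 + 1) / 3) := by
      rw [hs_def]
      field_simp
    have hr : 0 < 12 / 25 * (1 / √s) := by positivity
    have hvol := volume_le_nVar (μ := μ) (lam := lam) hr (E := {x | 1 / √s ≤ dFun μ x})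
      (fun x hx => ?_) ?_
    · rw [hMd s hs]
      calc _ ≤ 2 * (ENNReal.ofReal √s *
            (NVar μ 0 lam * ENNReal.ofReal (12 / 25 * (1 / √s)))) := by gcongr
        _ = ENNReal.ofReal (2 * √s * (12 / 25 * (1 / √s))) * NVar μ 0 lam := by
          rw [ENNReal.ofReal_mul (by positivity : 0 ≤ 2 * √s), ENNReal.ofReal_mul two_pos.le,
            ENNReal.ofReal_ofNat]
          ring
        _ ≤ NVar μ 0 lam := by
          refine mul_le_of_le_one_left' (ENNReal.ofReal_le_one.2 ?_)
          field_simp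
          norm_num
    · have h1 : 1 / √s ≤ dFun μ x := hx
      have h2 : 0 < 1 / √s := by positivity
      linarith
    · have h1 : lam * (12 / 25 * (1 / √s)) ^ 2 = 768 / 625 * (Real.pi ^ 2 + 1) := by
        rw [mul_pow, div_pow _ √s, hsq, hs_eq]
        field_simp
        norm_num
      rw [h1]
      nlinarith [Real.pi_gt_three]
  · have h4 : 0 < 4 * lam := by positivity
    have h := nVar_le hμ (l := 1 / √(4 * lam)) (by positivity)
    have hl : 1 / (4 * (1 / √(4 * lam)) ^ 2) = lam := by
      rw [div_pow, Real.sq_sqrt h4.le]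
      field_simp
    rw [hl] at h
    rwa [hMd _ h4, mul_comm, ← one_div_one_div √(4 * lam), one_div (1 / √(4 * lam)),
      ENNReal.ofReal_inv_of_pos (by positivity), ← div_eq_mul_inv, inv_eq_one_div, one_div_one_div]
end
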